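/- Under the carry-sequence setup, if for some index i and some integer r ≥ 1 we have c_i = 5 and c_{i−1} = c_{i−2} = ⋯ = c_{i−r} = 4, then c_{i−r−1} ≤ 4. -/

import Mathlib

/-- Along a run of carries equal to `4` that precedes a carry `5`, the digits satisfy a pair of
linear constraints. -/
theorem digit_bounds_of_carry_five_run_of_fours
    (a b c : ℤ → ℤ)
    (ha : ∀ i, 0 ≤ a i ∧ a i ≤ 2) (hb : ∀ i, 0 ≤ b i ∧ b i ≤ 2)
    (hs : ∀ i, 0 ≤ (9 - 2 * a (i - 1) + a i - b (i - 2) + b (i - 1) - b i) - 3 * c i + c (i - 1) ∧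
      (9 - 2 * a (i - 1) + a i - b (i - 2) + b (i - 1) - b i) - 3 * c i + c (i - 1) ≤ 2)
    (i r : ℤ) (hr : 1 ≤ r) (h5 : c i = 5) (h4 : ∀ j : ℤ, 1 ≤ j → j ≤ r → c (i - j) = 4) :
    b (i - r - 1) + 2 * a (i - r) ≤ 2 ∧ b (i - r - 1) + 2 * a (i - r) ≤ b (i - r) + 1 := by
  induction r, hr using Int.leInduction with
  | base =>
    have h := h4 1 le_rfl le_rfl
    have hsi := hs i
    rw [show i - 1 - 1 = i - 2 by ring]
    have := ha i
    have := hb i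
    have := hb (i - 1)
    omega
  | succ n hn ih =>
    have h := ih fun j hj hjn => h4 j hj (by omega)
    have hn4 := h4 n hn (by omega)
    have hn4' := h4 (n + 1) (by omega) le_rfl
    have hsn := hs (i - n)
    rw [show i - (n + 1) - 1 = i - n - 2 by ring, show i - (n + 1) = i - n - 1 by ring] at *
    have := ha (i - n)
    have := hb (i - n)
    have := hb (i - n - 1)
    omega

/-- In the carry-sequence setup, if `c_i = 5` and `c_{i−1} = ⋯ = c_{i−r} = 4` for some
`r ≥ 1`, then `c_{i−r−1} ≤ 4`. -/
theorem carry_five_run_of_fours_then_le_four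
    (m : ℕ) (hm : 0 < m)
    (a b c : ℤ → ℤ)
    (ha : ∀ i, 0 ≤ a i ∧ a i ≤ 2) (hap : ∀ i, a (i + (m : ℤ)) = a i)
    (hb : ∀ i, 0 ≤ b i ∧ b i ≤ 2) (hbp : ∀ i, b (i + (m : ℤ)) = b i)
    (hc : ∀ i, 0 ≤ c i ∧ c i ≤ 6) (hcp : ∀ i, c (i + (m : ℤ)) = c i)
    (hs : ∀ i, 0 ≤ (9 - 2 * a (i - 1) + a i - b (i - 2) + b (i - 1) - b i) - 3 * c i + c (i - 1) ∧
      (9 - 2 * a (i - 1) + a i - b (i - 2) + b (i - 1) - b i) - 3 * c i + c (i - 1) ≤ 2) :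
    ∀ i, ∀ r : ℤ, 1 ≤ r → c i = 5 → (∀ j : ℤ, 1 ≤ j → j ≤ r → c (i - j) = 4) →
      c (i - r - 1) ≤ 4 := by
  intro i r hr h5 h4
  obtain ⟨h1, h2⟩ := digit_bounds_of_carry_five_run_of_fours a b c ha hb hs i r hr h5 h4
  have hr4 := h4 r hr le_rfl
  by_contra! hlt
  generalize i - r = t at *
  clear h4 hap hbp hcp h5 hm
  have s0 := hs t
  have s1 := hs (t - 1)
  have s2 := hs (t - 2)
  have s3 := hs (t - 3)
  have s4 := hs (t - 4)
  simp only [sub_sub, Int.reduceAdd] at s0 s1 s2 s3 s4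
  have a0 := ha t
  have a1 := ha (t - 1)
  have a2 := ha (t - 2)
  have a3 := ha (t - 3)
  have a4 := ha (t - 4)
  have a5 := ha (t - 5)
  have b0 := hb t
  have b1 := hb (t - 1)
  have b2 := hb (t - 2)
  have b3 := hb (t - 3)
  have b4 := hb (t - 4)
  have b5 := hb (t - 5)
  have b6 := hb (t - 6)
  have c1 := hc (t - 1)
  have c2 := hc (t - 2)
  have c3 := hc (t - 3)
  have c4 := hc (t - 4)
  have c5 := hc (t - 5)
  clear hs ha hb hc
  have u1 : 2 * a (t - 1) + b (t - 2) ≤ c (t - 1) - 2 := by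
    clear s1 s2 s3 s4; omega
  have u1' : 2 * a (t - 1) + b (t - 2) ≤ c (t - 1) - 3 + b (t - 1) := by
    clear s1 s2 s3 s4; omega
  clear s0 h1 h2 a0 b0
  have u2 : 2 * a (t - 2) + b (t - 3) ≤ c (t - 2) - 4 := by
    linarith
  have u2' : 2 ≤ b (t - 2) ∨ 5 ≤ c (t - 2) := by
    clear s2 s3 s4; omega
  clear s1 u1 u1' a1 b1
  have u3 : 2 * a (t - 3) + b (t - 4) ≤ c (t - 3) - 5 := by
    clear s3 s4; rcases u2' with h | h <;> linarith
  clear s2 u2 u2' a2 b2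
  have u4 : 2 * a (t - 4) + b (t - 5) ≤ c (t - 4) - 6 := by
    linarith
  linarith
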